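/- arXiv:1107.2965 — 3 statements merged into one kernel-verified Lean document; each statement's English description precedes it below -/
import Mathlib

section
/- Let $m \ge 1$ and let $\lambda, \tilde\lambda, \nu, \tilde\nu : \{1,\dots,m\} \to \mathbb{R}$. Assume: (i) $0 < \lambda_i < 1$ for all $i$ and $\lambda_1 \ge \lambda_2 \ge \dots \ge \lambda_m$, and set $\gamma = \lambda_1 - \lambda_m$; (ii) $|\lambda_i - \tilde\lambda_i| \le \varepsilon$ for all $i$, where $\varepsilon \ge 0$ and $\lambda_1 + \varepsilon < 1$; (iii) $\sum_{i=1}^m \tilde\nu_i^2 \le 1$ and $\sum_{i=1}^m \nu_i^2 = 1$. Then $\sum_{i=1}^m \frac{\tilde\nu_i^2}{1 - \tilde\lambda_i} - \sum_{i=1}^m \frac{\nu_i^2}{1 - \lambda_i} \le \frac{1}{1 - \lambda_1 - \varepsilon} - \frac{1}{1 - \lambda_1 + \gamma}$. -/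
open Finset

/-- **Lemma of Section 3.2 of the paper (delayed perturbed hitting time).**
For eigenvalues `0 < λᵢ < 1` in decreasing order with `γ = λ₁ - λₘ`, perturbed
eigenvalues with `|λᵢ - λ̃ᵢ| ≤ ε` where `λ₁ + ε < 1`, and coefficients with
`∑ ν̃ᵢ² ≤ 1` and `∑ νᵢ² = 1`, the delayed perturbed hitting time satisfies
`∑ ν̃ᵢ²/(1-λ̃ᵢ) - ∑ νᵢ²/(1-λᵢ) ≤ 1/(1-λ₁-ε) - 1/(1-λ₁+γ)`. -/
theorem delayed_perturbed_hitting_time {m : ℕ} (hm : 1 ≤ m)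
    (lam tlam ν tν : Fin m → ℝ)
    (hpos : ∀ i, 0 < lam i) (hlt : ∀ i, lam i < 1)
    (hdec : Antitone lam)
    (γ : ℝ) (hγ : γ = lam ⟨0, by omega⟩ - lam ⟨m - 1, by omega⟩)
    (ε : ℝ) (hε : 0 ≤ ε)
    (hpert : ∀ i, |lam i - tlam i| ≤ ε)
    (htop : lam ⟨0, by omega⟩ + ε < 1)
    (htνsum : ∑ i, tν i ^ 2 ≤ 1) (hνsum : ∑ i, ν i ^ 2 = 1) :
    ∑ i, tν i ^ 2 / (1 - tlam i) - ∑ i, ν i ^ 2 / (1 - lam i) ≤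
      1 / (1 - lam ⟨0, by omega⟩ - ε) - 1 / (1 - lam ⟨0, by omega⟩ + γ) := by
  have h0 : ∀ i, lam i ≤ lam ⟨0, by omega⟩ := fun i => hdec (Fin.mk_le_of_le_val (Nat.zero_le _))
  have hl : ∀ i, lam ⟨m - 1, by omega⟩ ≤ lam i := fun i =>
    hdec (by rw [Fin.le_def]; have := i.2; simp only; omega)
  have h1 : ∑ i, tν i ^ 2 / (1 - tlam i) ≤ 1 / (1 - lam ⟨0, by omega⟩ - ε) := by
    calc ∑ i, tν i ^ 2 / (1 - tlam i)
        ≤ ∑ i, tν i ^ 2 / (1 - lam ⟨0, by omega⟩ - ε) := by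
          apply Finset.sum_le_sum
          intro i _
          have ha := (abs_le.mp (hpert i)).1
          have hb := h0 i
          exact div_le_div_of_nonneg_left (sq_nonneg _) (by linarith) (by linarith)
      _ = (∑ i, tν i ^ 2) / (1 - lam ⟨0, by omega⟩ - ε) := by rw [Finset.sum_div]
      _ ≤ _ := div_le_div_of_nonneg_right htνsum (by linarith)
  have h2 : 1 / (1 - lam ⟨0, by omega⟩ + γ) ≤ ∑ i, ν i ^ 2 / (1 - lam i) := by
    rw [← hνsum, Finset.sum_div]
    apply Finset.sum_le_sum
    intro i _
    have hb := hl i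
    have hc := hlt i
    exact div_le_div_of_nonneg_left (sq_nonneg _) (by linarith) (by linarith)
  linarith
end

section
/- Let $m \ge 1$ and let $\lambda, \tilde\lambda, \nu, \tilde\nu : \{1,\dots,m\} \to \mathbb{R}$. Assume: (i) $0 < \lambda_i < 1$ for all $i$ and $\lambda_1 \ge \lambda_2 \ge \dots \ge \lambda_m$, and set $\gamma = \lambda_1 - \lambda_m$; (ii) $|\lambda_i - \tilde\lambda_i| \le \varepsilon$ for all $i$, where $\varepsilon \ge 0$, $0 < \lambda_1 + \varepsilon < 1$, and $0 < \tilde\lambda_i < 1$ for all $i$; (iii) $\sum_{i=1}^m \tilde\nu_i^2 \le 1$ and $\sum_{i=1}^m \nu_i^2 = 1$. Then $\sum_{i=1}^m \frac{\tilde\nu_i^2}{\arccos \tilde\lambda_i} - \sum_{i=1}^m \frac{\nu_i^2}{\arccos \lambda_i} \le \frac{1}{\sqrt{1 - \lambda_1 - \varepsilon}} - \frac{1}{2\sqrt{1 - \lambda_1 + \gamma}}$. -/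
open Finset

theorem aux_lower (x : ℝ) (h0 : 0 < x) (h1 : x < 1) :
    Real.sqrt (1 - x) ≤ Real.arccos x := by
  have hc : Real.cos (Real.arccos x) = x := Real.cos_arccos (by linarith) h1.le
  have h := Real.one_sub_sq_div_two_le_cos (x := Real.arccos x)
  rw [hc] at h
  apply Real.sqrt_le_iff.mpr
  exact ⟨Real.arccos_nonneg x, by nlinarith⟩

theorem aux_upper (x : ℝ) (h0 : 0 < x) (h1 : x < 1) :
    Real.arccos x ≤ 2 * Real.sqrt (1 - x) := by
  have hc : Real.cos (Real.arccos x) = x := Real.cos_arccos (by linarith) h1.le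
  have hp : 0 < Real.arccos x := Real.arccos_pos.mpr h1
  have hl : Real.arccos x < Real.pi / 2 := Real.arccos_lt_pi_div_two.mpr h0
  have hpi := Real.pi_lt_d2
  obtain ⟨t, ht⟩ : ∃ t, t = Real.arccos x / 2 := ⟨_, rfl⟩
  have hθ : Real.arccos x = 2 * t := by linarith
  rw [hθ] at hc hp hl ⊢
  have ht0 : 0 < t := by linarith
  have ht1 : t < 0.8 := by linarith
  have hs := Real.sin_gt_sub_cube ht0
  have hs2 : 0.8 * t ≤ Real.sin t := by nlinarith [mul_pos ht0 ht0, mul_pos ht0 (sub_pos.mpr ht1)]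
  have hsq : (0.8 * t) ^ 2 ≤ Real.sin t ^ 2 := by gcongr
  rw [Real.cos_two_mul] at hc
  have hcs := Real.sin_sq_add_cos_sq t
  have : t ≤ Real.sqrt (1 - x) := Real.le_sqrt_of_sq_le (by nlinarith)
  linarith

/-- **Lemma of Section 3.5 of the paper (delayed perturbed quantum hitting time).**
For eigenvalues `0 < λᵢ < 1` in decreasing order with `γ = λ₁ - λₘ`, perturbed
eigenvalues `0 < λ̃ᵢ < 1` with `|λᵢ - λ̃ᵢ| ≤ ε` where `0 < λ₁ + ε < 1`, and
coefficients with `∑ ν̃ᵢ² ≤ 1` and `∑ νᵢ² = 1`, the delayed perturbed quantum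
hitting time satisfies
`∑ ν̃ᵢ²/arccos λ̃ᵢ - ∑ νᵢ²/arccos λᵢ ≤ 1/√(1-λ₁-ε) - 1/(2√(1-λ₁+γ))`. -/
theorem delayed_perturbed_quantum_hitting_time {m : ℕ} (hm : 1 ≤ m)
    (lam tlam ν tν : Fin m → ℝ)
    (hpos : ∀ i, 0 < lam i) (hlt : ∀ i, lam i < 1)
    (hdec : Antitone lam)
    (γ : ℝ) (hγ : γ = lam ⟨0, by omega⟩ - lam ⟨m - 1, by omega⟩)
    (ε : ℝ) (hε : 0 ≤ ε)
    (hpert : ∀ i, |lam i - tlam i| ≤ ε)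
    (htop0 : 0 < lam ⟨0, by omega⟩ + ε) (htop1 : lam ⟨0, by omega⟩ + ε < 1)
    (htpos : ∀ i, 0 < tlam i) (htlt : ∀ i, tlam i < 1)
    (htνsum : ∑ i, tν i ^ 2 ≤ 1) (hνsum : ∑ i, ν i ^ 2 = 1) :
    ∑ i, tν i ^ 2 / Real.arccos (tlam i) - ∑ i, ν i ^ 2 / Real.arccos (lam i) ≤
      1 / Real.sqrt (1 - lam ⟨0, by omega⟩ - ε) -
        1 / (2 * Real.sqrt (1 - lam ⟨0, by omega⟩ + γ)) := by
  have hL : ∀ i, lam i ≤ lam ⟨0, by omega⟩ := fun i => hdec (Fin.mk_le_of_le_val (Nat.zero_le _))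
  have hM : ∀ i, lam ⟨m - 1, by omega⟩ ≤ lam i := fun i => hdec (by
    rw [Fin.le_def]; have := i.2; simp only; omega)
  have hA : ∑ i, tν i ^ 2 / Real.arccos (tlam i) ≤
      1 / Real.sqrt (1 - lam ⟨0, by omega⟩ - ε) := by
    have hs : 0 < Real.sqrt (1 - lam ⟨0, by omega⟩ - ε) := Real.sqrt_pos.mpr (by linarith)
    calc ∑ i, tν i ^ 2 / Real.arccos (tlam i)
        ≤ ∑ i, tν i ^ 2 / Real.sqrt (1 - lam ⟨0, by omega⟩ - ε) := by
          apply Finset.sum_le_sum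
          intro i _
          apply div_le_div_of_nonneg_left (sq_nonneg _) hs
          refine le_trans (Real.sqrt_le_sqrt ?_) (aux_lower _ (htpos i) (htlt i))
          have h1 := (abs_le.mp (hpert i)).1
          have h2 := hL i
          linarith
      _ = (∑ i, tν i ^ 2) / Real.sqrt (1 - lam ⟨0, by omega⟩ - ε) :=
          (Finset.sum_div _ _ _).symm
      _ ≤ _ := div_le_div_of_nonneg_right htνsum hs.le
  have hB : 1 / (2 * Real.sqrt (1 - lam ⟨0, by omega⟩ + γ)) ≤
      ∑ i, ν i ^ 2 / Real.arccos (lam i) := by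
    rw [← hνsum, Finset.sum_div]
    apply Finset.sum_le_sum
    intro i _
    apply div_le_div_of_nonneg_left (sq_nonneg _) (Real.arccos_pos.mpr (hlt i))
    refine (aux_upper _ (hpos i) (hlt i)).trans ?_
    have h2 := hM i
    have : Real.sqrt (1 - lam i) ≤ Real.sqrt (1 - lam ⟨0, by omega⟩ + γ) :=
      Real.sqrt_le_sqrt (by rw [hγ]; linarith)
    rw [hνsum]; linarith
  linarith
end

section
/- Fix $n \ge 1$ and a column-stochastic matrix $\tilde{P} \in \mathbb{R}^{n\times n}$ (all entries nonnegative and each column sums to $1$). Define the complex matrix $A$ of size $n^2 \times n$, with rows indexed by pairs $(z,y) \in \{1,\dots,n\}^2$ and columns by $y' \in \{1,\dots,n\}$, by $A_{(z,y),y'} = \sqrt{\tilde{P}_{zy}}$ if $y = y'$ and $0$ otherwise; let $\Pi_{\mathcal{A}} = A A^{\dagger}$ (the orthogonal projector onto the span of the vectors $|y\rangle|p_y\rangle$, where $|p_y\rangle = \sum_z \sqrt{\tilde{P}_{zy}}|z\rangle$); let $S$ be the $n^2 \times n^2$ swap matrix $S_{(a,b),(c,d)} = 1$ if $a = d$ and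 $b = c$, and $0$ otherwise; and let $U = S(2\Pi_{\mathcal{A}} - I)$. Define the $n \times n$ real matrix $D$ by $D_{jk} = \sqrt{\tilde{P}_{jk}\tilde{P}_{kj}}$. Then for every real eigenvalue $\lambda$ of $D$ with $-1 < \lambda < 1$ (i.e., there exists $v \ne 0$ with $Dv = \lambda v$), both $\lambda + i\sqrt{1 - \lambda^2}$ and $\lambda - i\sqrt{1 - \lambda^2}$ are eigenvalues of $U$ (i.e., each admits a nonzero eigenvector in $\mathbb{C}^{n^2}$). -/
open Finset Matrix

theorem szegedy_aux {n : ℕ} (A : Matrix (Fin n × Fin n) (Fin n) ℂ)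
    (S : Matrix (Fin n × Fin n) (Fin n × Fin n) ℂ)
    (D : Matrix (Fin n) (Fin n) ℂ)
    (h1 : Aᴴ * A = 1) (h2 : S * S = 1) (h3 : Aᴴ * (S * A) = D)
    (l m : ℂ) (hm : m ^ 2 - 2 * l * m + 1 = 0) (hl : l ^ 2 ≠ 1)
    (v : Fin n → ℂ) (hv : v ≠ 0) (hDv : D *ᵥ v = l • v) :
    ∃ w : Fin n × Fin n → ℂ, w ≠ 0 ∧
      (S * ((2 : ℂ) • (A * Aᴴ) - 1)) *ᵥ w = m • w := by
  have e1 : Aᴴ *ᵥ (A *ᵥ v) = v := by simp [Matrix.mulVec_mulVec, h1]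
  have e2 : Aᴴ *ᵥ (S *ᵥ (A *ᵥ v)) = l • v := by
    rw [Matrix.mulVec_mulVec, Matrix.mulVec_mulVec, Matrix.mul_assoc, h3, hDv]
  have e3 : S *ᵥ (S *ᵥ (A *ᵥ v)) = A *ᵥ v := by
    rw [Matrix.mulVec_mulVec, h2, Matrix.one_mulVec]
  have key : ∀ x, (S * ((2 : ℂ) • (A * Aᴴ) - 1)) *ᵥ x
      = (2 : ℂ) • (S *ᵥ (A *ᵥ (Aᴴ *ᵥ x))) - S *ᵥ x := by
    intro x
    rw [← Matrix.mulVec_mulVec, Matrix.sub_mulVec, Matrix.one_mulVec, Matrix.smul_mulVec,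
      Matrix.mulVec_sub, Matrix.mulVec_smul, ← Matrix.mulVec_mulVec]
  refine ⟨A *ᵥ v - m • (S *ᵥ (A *ᵥ v)), ?_, ?_⟩
  · intro h0
    have h := congrArg (fun x => Aᴴ *ᵥ x) h0
    simp only [Matrix.mulVec_sub, Matrix.mulVec_smul, e1, e2, Matrix.mulVec_zero] at h
    obtain ⟨i, hi⟩ := Function.ne_iff.mp hv
    have hh := congrFun h i
    simp only [Pi.sub_apply, Pi.smul_apply, smul_eq_mul, Pi.zero_apply] at hh hi
    have hml : m * l = 1 := by
      apply mul_right_cancel₀ hi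
      linear_combination -hh
    have hm2 : m ^ 2 = 1 := by linear_combination hm + 2 * hml
    apply hl
    linear_combination (m * l + 1) * hml - l ^ 2 * hm2
  · rw [key]
    simp only [Matrix.mulVec_sub, Matrix.mulVec_smul, e1, e2, e3]
    ext i
    simp only [Pi.sub_apply, Pi.smul_apply, smul_eq_mul]
    linear_combination ((S *ᵥ (A *ᵥ v)) i) * hm

/-- **Szegedy's spectral theorem (Theorem 1 of the paper).** For a column-stochastic
matrix `P̃`, with `A` the isometry `A_{(z,y),y'} = √(P̃_{zy})·[y = y']`,
`Π = A Aᴴ`, `S` the swap matrix, `U = S (2Π - I)`, and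
`D_{jk} = √(P̃_{jk} P̃_{kj})`: every real eigenvalue `λ` of `D` with `-1 < λ < 1`
gives rise to eigenvalues `λ ± i √(1 - λ²)` of `U`. -/
theorem szegedy_walk_spectrum {n : ℕ} (hn : 1 ≤ n)
    (Pt : Matrix (Fin n) (Fin n) ℝ)
    (hnonneg : ∀ z y, 0 ≤ Pt z y)
    (hcol : ∀ y, ∑ z, Pt z y = 1)
    (A : Matrix (Fin n × Fin n) (Fin n) ℂ)
    (hA : ∀ z y y', A (z, y) y' = if y = y' then (Real.sqrt (Pt z y) : ℂ) else 0)
    (S : Matrix (Fin n × Fin n) (Fin n × Fin n) ℂ)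
    (hS : ∀ a b c d, S (a, b) (c, d) = if a = d ∧ b = c then 1 else 0)
    (U : Matrix (Fin n × Fin n) (Fin n × Fin n) ℂ)
    (hU : U = S * ((2 : ℂ) • (A * Aᴴ) - 1))
    (D : Matrix (Fin n) (Fin n) ℝ)
    (hD : ∀ j k, D j k = Real.sqrt (Pt j k * Pt k j))
    (lam : ℝ) (hlam₁ : -1 < lam) (hlam₂ : lam < 1)
    (hev : ∃ v : Fin n → ℝ, v ≠ 0 ∧ D.mulVec v = lam • v) :
    (∃ w : Fin n × Fin n → ℂ, w ≠ 0 ∧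
        U.mulVec w = ((lam : ℂ) + Complex.I * Real.sqrt (1 - lam ^ 2)) • w) ∧
      (∃ w : Fin n × Fin n → ℂ, w ≠ 0 ∧
        U.mulVec w = ((lam : ℂ) - Complex.I * Real.sqrt (1 - lam ^ 2)) • w) := by
  obtain ⟨v, hv, hDv⟩ := hev
  have h1 : Aᴴ * A = 1 := by
    ext j k
    simp only [Matrix.mul_apply, Matrix.conjTranspose_apply, Fintype.sum_prod_type, hA,
      Matrix.one_apply]
    by_cases hjk : j = k
    · subst hjk
      simp only [if_true]
      have : ∀ z, (∑ y, star (if y = j then (Real.sqrt (Pt z y) : ℂ) else 0) *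
          (if y = j then (Real.sqrt (Pt z y) : ℂ) else 0)) = (Pt z j : ℂ) := by
        intro z
        rw [Finset.sum_eq_single j]
        · simp [← Complex.ofReal_mul, Real.mul_self_sqrt (hnonneg z j)]
        · intro b _ hb
          simp [hb]
        · simp
      rw [Finset.sum_congr rfl (fun z _ => this z)]
      exact_mod_cast hcol j
    · rw [if_neg hjk]
      refine Finset.sum_eq_zero fun z _ => Finset.sum_eq_zero fun y _ => ?_
      by_cases hy : y = j
      · subst hy
        simp [hjk]
      · simp [hy]
  have hSm : ∀ {m : Type} (M : Matrix (Fin n × Fin n) m ℂ) a b k,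
      (S * M) (a, b) k = M (b, a) k := by
    intro m M a b k
    rw [Matrix.mul_apply, Finset.sum_eq_single (b, a)]
    · simp [hS]
    · rintro ⟨c, d⟩ _ hcd
      rw [hS, if_neg, zero_mul]
      rintro ⟨rfl, rfl⟩
      exact hcd rfl
    · simp
  have h2 : S * S = 1 := by
    ext ⟨a, b⟩ ⟨c, d⟩
    rw [hSm, hS, Matrix.one_apply]
    simp [Prod.ext_iff, and_comm]
  have h3 : Aᴴ * (S * A) = D.map (fun x : ℝ => (x : ℂ)) := by
    ext j k
    rw [Matrix.mul_apply, Finset.sum_eq_single (k, j)]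
    · simp [hSm, hA, hD, Real.sqrt_mul (hnonneg j k), mul_comm]
    · rintro ⟨z, y⟩ _ hne
      rw [hSm, Matrix.conjTranspose_apply, hA, hA]
      by_cases hy : y = j
      · by_cases hz : z = k
        · exact absurd (by rw [hy, hz]) hne
        · simp [hz]
      · simp [hy]
    · simp
  have hDv' : (D.map (fun x : ℝ => (x : ℂ))) *ᵥ (fun i => (v i : ℂ))
      = (lam : ℂ) • (fun i => (v i : ℂ)) := by
    ext i
    have := congrFun hDv i
    simp only [Matrix.mulVec, dotProduct, Pi.smul_apply, smul_eq_mul, Matrix.map_apply] at this ⊢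
    exact_mod_cast this
  have hv' : (fun i => (v i : ℂ)) ≠ 0 := by
    intro h
    apply hv
    ext i
    have := congrFun h i
    simpa using this
  have hl : (lam : ℂ) ^ 2 ≠ 1 := by
    intro h
    have h' : lam ^ 2 = 1 := by exact_mod_cast h
    nlinarith
  have hs : (Real.sqrt (1 - lam ^ 2) : ℂ) ^ 2 = 1 - (lam : ℂ) ^ 2 := by
    have : Real.sqrt (1 - lam ^ 2) ^ 2 = 1 - lam ^ 2 := Real.sq_sqrt (by nlinarith)
    exact_mod_cast this
  rw [hU]
  constructor
  · refine szegedy_aux A S _ h1 h2 h3 lam _ ?_ hl _ hv' hDv'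
    linear_combination (Real.sqrt (1 - lam ^ 2) : ℂ) ^ 2 * Complex.I_sq - hs
  · refine szegedy_aux A S _ h1 h2 h3 lam _ ?_ hl _ hv' hDv'
    linear_combination (Real.sqrt (1 - lam ^ 2) : ℂ) ^ 2 * Complex.I_sq - hs
end
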